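/- arXiv:1403.6714 — 2 statements merged into one kernel-verified Lean document; each statement's English description precedes it below -/
import Mathlib

section
/- The number of (ordinary) Veldkamp lines of the binary Segre variety S_(2), i.e., of unordered triples {H', H'', H'''} of pairwise distinct geometric hyperplanes of S_(2) such that H''' is the complement of the symmetric difference H' Δ H'', is exactly 35. -/
open scoped symmDiff

/-- A point of the binary Segre variety `S_(N)`. -/
abbrev SegrePoint (N : ℕ) := Fin N → Fin 3

/-- The line of `S_(N)` through `f` in direction `i`. -/
def segreLine {N : ℕ} (i : Fin N) (f : SegrePoint N) : Set (SegrePoint N) :=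
  {x | ∀ j, j ≠ i → x j = f j}

/-- A geometric hyperplane of `S_(N)`: a proper subset of the point set such that
every line either lies fully in it or meets it in exactly one point. -/
def IsGeomHyperplane {N : ℕ} (H : Set (SegrePoint N)) : Prop :=
  H ≠ Set.univ ∧ ∀ (i : Fin N) (f : SegrePoint N),
    segreLine i f ⊆ H ∨ (segreLine i f ∩ H).ncard = 1

/-- Two points of `S_(N)` are collinear iff they differ in exactly one coordinate. -/
def SegreCollinear {N : ℕ} (x y : SegrePoint N) : Prop :=
  hammingDist x y = 1

/-- An ovoid of `S_(N)`: a set of `3^(N-1)` pairwise non-collinear points. -/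
def IsOvoid {N : ℕ} (O : Set (SegrePoint N)) : Prop :=
  O.ncard = 3 ^ (N - 1) ∧ O.Pairwise fun x y => ¬ SegreCollinear x y

/-- The three nonzero vectors of `𝔽₂²`, indexed by the points of a factor of `S_(2)`. -/
def segreVec : Fin 3 → Fin 2 → ZMod 2 := ![![1, 0], ![0, 1], ![1, 1]]

/-- The bilinear form on `𝔽₂² × 𝔽₂²` with Gram matrix `m`, evaluated at a point of `S_(2)`. -/
def segreForm (m : Fin 2 → Fin 2 → ZMod 2) (x : SegrePoint 2) : ZMod 2 :=
  ∑ i, ∑ j, segreVec (x 0) i * segreVec (x 1) j * m i j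

/-- The zero locus in `S_(2)` of the bilinear form with Gram matrix `m`. -/
def segreZeros (m : Fin 2 → Fin 2 → ZMod 2) : Set (SegrePoint 2) :=
  {x | segreForm m x = 0}

theorem segreForm_add (a b : Fin 2 → Fin 2 → ZMod 2) (x : SegrePoint 2) :
    segreForm (a + b) x = segreForm a x + segreForm b x := by
  simp only [segreForm, Pi.add_apply, mul_add, Finset.sum_add_distrib]

theorem segreForm_castSucc (m : Fin 2 → Fin 2 → ZMod 2) (i j : Fin 2) :
    segreForm m ![i.castSucc, j.castSucc] = m i j := by
  fin_cases i <;> fin_cases j <;> simp [segreForm, segreVec]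

theorem ZMod.two_eq_of_eq_zero_iff {a b : ZMod 2} (h : a = 0 ↔ b = 0) : a = b := by
  revert a b; decide

theorem segreZeros_injective : Function.Injective segreZeros := by
  intro a b h
  funext i j
  rw [← segreForm_castSucc a, ← segreForm_castSucc b]
  exact ZMod.two_eq_of_eq_zero_iff (Set.ext_iff.1 h _)

theorem segreZeros_add (a b : Fin 2 → Fin 2 → ZMod 2) :
    segreZeros (a + b) = (segreZeros a ∆ segreZeros b)ᶜ := by
  have key : ∀ p q : ZMod 2, p + q = 0 ↔ ¬ ((p = 0 ∧ ¬ q = 0) ∨ (q = 0 ∧ ¬ p = 0)) := by decide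
  ext x
  simpa only [segreZeros, Set.mem_ofPred_eq, segreForm_add, Set.mem_compl_iff,
    Set.mem_symmDiff] using key _ _

theorem segreLine_eq_range {N : ℕ} (i : Fin N) (f : SegrePoint N) :
    segreLine i f = Set.range (Function.update f i) := by
  ext x
  refine ⟨fun h => ⟨x i, ?_⟩, ?_⟩
  · rw [Function.update_eq_iff]
    exact ⟨rfl, fun j hj => (h j hj).symm⟩
  · rintro ⟨a, rfl⟩ j hj
    exact Function.update_of_ne hj _ _

/-- A line meets the zero set of an `𝔽₂`-valued function `c` as required of a hyperplane
iff `c` sums to zero along the line. -/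
theorem segreLine_zeros_iff {N : ℕ} (c : SegrePoint N → ZMod 2) (i : Fin N) (f : SegrePoint N) :
    (segreLine i f ⊆ {x | c x = 0} ∨ (segreLine i f ∩ {x | c x = 0}).ncard = 1) ↔
      ∑ a, c (Function.update f i a) = 0 := by
  have hinter : segreLine i f ∩ {x | c x = 0} = Function.update f i ''
      ↑(Finset.univ.filter fun a => c (Function.update f i a) = 0) := by
    rw [segreLine_eq_range]
    ext x
    constructor
    · rintro ⟨⟨a, rfl⟩, h⟩
      exact ⟨a, by simpa using h, rfl⟩
    · rintro ⟨a, h, rfl⟩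
      exact ⟨⟨a, rfl⟩, by simpa using h⟩
  have key : ∀ g : Fin 3 → ZMod 2,
      ((∀ a, g a = 0) ∨ (Finset.univ.filter fun a => g a = 0).card = 1) ↔ ∑ a, g a = 0 := by
    decide
  rw [hinter, Set.ncard_image_of_injective _ (Function.update_injective f i),
    Set.ncard_coe_finset, segreLine_eq_range, Set.range_subset_iff]
  exact key _

theorem sum_segreForm_update (m : Fin 2 → Fin 2 → ZMod 2) (i : Fin 2) (f : SegrePoint 2) :
    ∑ a, segreForm m (Function.update f i a) = 0 := by
  have hv : ∀ j, ∑ a, segreVec a j = 0 := by decide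
  fin_cases i <;>
    simp [segreForm, Finset.sum_add_distrib, ← Finset.sum_mul, ← Finset.mul_sum, hv]

theorem eq_segreForm_of_sum_update {c : SegrePoint 2 → ZMod 2}
    (hc : ∀ i f, ∑ a, c (Function.update f i a) = 0) :
    c = segreForm fun i j => c ![i.castSucc, j.castSucc] := by
  have hfst : ∀ p q a : Fin 3, Function.update ![p, q] 0 a = ![a, q] := by decide
  have hsnd : ∀ p q a : Fin 3, Function.update ![p, q] 1 a = ![p, a] := by decide
  have h0 : ∀ b, c ![2, b] = c ![0, b] + c ![1, b] := fun b => by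
    have := hc 0 ![0, b]
    rw [Fin.sum_univ_three, hfst, hfst, hfst] at this
    exact (CharTwo.add_eq_zero.1 this).symm
  have h1 : ∀ a, c ![a, 2] = c ![a, 0] + c ![a, 1] := fun a => by
    have := hc 1 ![a, 0]
    rw [Fin.sum_univ_three, hsnd, hsnd, hsnd] at this
    exact (CharTwo.add_eq_zero.1 this).symm
  funext x
  obtain ⟨a, b, rfl⟩ : ∃ a b, x = ![a, b] := ⟨x 0, x 1, by ext i; fin_cases i <;> rfl⟩
  fin_cases a <;> fin_cases b <;> simp [segreForm, segreVec, h0, h1]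

theorem isGeomHyperplane_iff_exists_segreZeros {H : Set (SegrePoint 2)} :
    IsGeomHyperplane H ↔ ∃ m, m ≠ 0 ∧ segreZeros m = H := by
  classical
  have huniv : segreZeros 0 = Set.univ := by ext; simp [segreZeros, segreForm]
  constructor
  · rintro ⟨hne, hH⟩
    obtain ⟨c, rfl⟩ : ∃ c : SegrePoint 2 → ZMod 2, H = {x | c x = 0} :=
      ⟨fun x => if x ∈ H then 0 else 1, by ext; simp⟩
    have hc := eq_segreForm_of_sum_update fun i f => (segreLine_zeros_iff c i f).1 (hH i f)
    refine ⟨fun i j => c ![i.castSucc, j.castSucc], fun h => hne ?_, ?_⟩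
    · rw [h] at hc
      rw [← huniv, hc, segreZeros]
    · rw [segreZeros, ← hc]
  · rintro ⟨m, hm, rfl⟩
    refine ⟨fun h => hm (segreZeros_injective (h.trans huniv.symm)), fun i f => ?_⟩
    exact (segreLine_zeros_iff (segreForm m) i f).2 (sum_segreForm_update m i f)

/-- The lines of the projective space `PG(3, 2)` on the `2 × 2` matrices over `𝔽₂`. -/
def gramLines : Finset (Finset (Fin 2 → Fin 2 → ZMod 2)) :=
  ((Finset.univ.erase 0).powersetCard 3).filter fun s => ∑ m ∈ s, m = 0

theorem card_gramLines : gramLines.card = 35 := by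
  decide +kernel

theorem mem_gramLines {s : Finset (Fin 2 → Fin 2 → ZMod 2)} :
    s ∈ gramLines ↔ ∃ a b, a ≠ 0 ∧ b ≠ 0 ∧ a ≠ b ∧ s = {a, b, a + b} := by
  have hchar : ∀ a : Fin 2 → Fin 2 → ZMod 2, a + a = 0 := fun a => by
    funext i j
    exact CharTwo.add_self_eq_zero _
  simp only [gramLines, Finset.mem_filter, Finset.mem_powersetCard, Finset.subset_erase,
    Finset.subset_univ, true_and, Finset.card_eq_three]
  constructor
  · rintro ⟨⟨h0, a, b, c, hab, hac, hbc, rfl⟩, hsum⟩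
    have hc : c = a + b := by
      rw [Finset.sum_insert (by simp [hab, hac]), Finset.sum_pair hbc, ← add_assoc] at hsum
      rw [← add_zero (a + b), ← hchar c, ← add_assoc, hsum, zero_add]
    simp only [Finset.mem_insert, Finset.mem_singleton, not_or] at h0
    exact ⟨a, b, Ne.symm h0.1, Ne.symm h0.2.1, hab, by rw [hc]⟩
  · rintro ⟨a, b, ha, hb, hab, rfl⟩
    have ha' : a ≠ a + b := by simpa using hb
    have hb' : b ≠ a + b := by simpa using ha
    have h0 : 0 ≠ a + b := fun h => hab <| by
      rw [← add_zero a, ← hchar b, ← add_assoc, ← h, zero_add]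
    refine ⟨⟨by simp [ha.symm, hb.symm, h0], a, b, a + b, hab, ha', hb', rfl⟩, ?_⟩
    rw [Finset.sum_insert (by simp [hab, hb]), Finset.sum_pair hb', ← add_assoc, hchar]

theorem segre2_veldkamp_line_count :
    {T : Set (Set (SegrePoint 2)) |
      ∃ H' H'' H''' : Set (SegrePoint 2),
        IsGeomHyperplane H' ∧ IsGeomHyperplane H'' ∧ IsGeomHyperplane H''' ∧
        H' ≠ H'' ∧ H' ≠ H''' ∧ H'' ≠ H''' ∧
        H''' = (H' ∆ H'')ᶜ ∧ T = {H', H'', H'''}}.ncard = 35 := by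
  have himage : Function.Injective
      fun s : Finset (Fin 2 → Fin 2 → ZMod 2) => segreZeros '' (s : Set _) :=
    segreZeros_injective.image_injective.comp Finset.coe_injective
  rw [← card_gramLines, ← Set.ncard_coe_finset, ← Set.ncard_image_of_injective _ himage]
  congr 1
  ext T
  simp only [Set.mem_ofPred_eq, Set.mem_image, Finset.mem_coe, mem_gramLines,
    isGeomHyperplane_iff_exists_segreZeros]
  constructor
  · rintro ⟨_, _, _, ⟨a, ha, rfl⟩, ⟨b, hb, rfl⟩, -, hab, -, -, rfl, rfl⟩
    refine ⟨_, ⟨a, b, ha, hb, fun h => hab (h ▸ rfl), rfl⟩, ?_⟩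
    simp [Set.image_insert_eq, segreZeros_add]
  · rintro ⟨_, ⟨a, b, ha, hb, hab, rfl⟩, rfl⟩
    have h0 : a + b ≠ 0 := fun h => hab <| by
      funext i j
      exact CharTwo.add_eq_zero.1 (congrFun (congrFun h i) j)
    refine ⟨_, _, _, ⟨a, ha, rfl⟩, ⟨b, hb, rfl⟩, ⟨a + b, h0, rfl⟩,
      segreZeros_injective.ne hab, segreZeros_injective.ne (by simpa using hb),
      segreZeros_injective.ne (by simpa using ha), segreZeros_add a b, ?_⟩
    simp [Set.image_insert_eq]
end

section
/- Every geometric hyperplane of the binary Segre variety S_(4) has a number of points belonging to the set {65, 57, 53, 51, 49, 47, 45, 43, 41, 39, 37, 35, 33, 31, 27}. -/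
open scoped symmDiff

namespace Segre

/-- A Boolean function on `S_(n)` is additive if its values on every line sum to zero. -/
def IsAdditive {n : ℕ} (h : SegrePoint n → Bool) : Prop :=
  ∀ i f, h (Function.update f i 2) = (h (Function.update f i 0) ^^ h (Function.update f i 1))

/-- The restriction of `h` to the points whose first coordinate is `k`. -/
def slice {n : ℕ} (h : SegrePoint (n + 1) → Bool) (k : Fin 3) : SegrePoint n → Bool :=
  fun x => h (Fin.cons k x)

/-- The values of `h` at the points with coordinates `0` and `1`, as the binary digits of a
natural number. -/
def code : ∀ n, (SegrePoint n → Bool) → ℕ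
  | 0, h => (h Fin.elim0).toNat
  | n + 1, h => code n (slice h 0) ^^^ code n (slice h 1) <<< 2 ^ n

/-- The number of points at which the additive function with code `a` is true. -/
def weight : ℕ → ℕ → ℕ
  | 0, a => a
  | n + 1, a =>
    weight n (a % 2 ^ 2 ^ n) + weight n (a >>> 2 ^ n) + weight n (a % 2 ^ 2 ^ n ^^^ a >>> 2 ^ n)

theorem IsAdditive.slice {n : ℕ} {h : SegrePoint (n + 1) → Bool} (hh : IsAdditive h)
    (k : Fin 3) : IsAdditive (slice h k) := by
  intro i f
  simpa only [Segre.slice, Fin.cons_update] using hh i.succ (Fin.cons k f)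

theorem IsAdditive.slice_two {n : ℕ} {h : SegrePoint (n + 1) → Bool} (hh : IsAdditive h) :
    Segre.slice h 2 = fun x => (Segre.slice h 0 x ^^ Segre.slice h 1 x) := by
  funext x
  simpa only [Segre.slice, Fin.update_cons_zero] using hh 0 (Fin.cons 0 x)

theorem code_lt : ∀ (n : ℕ) (h : SegrePoint n → Bool), code n h < 2 ^ 2 ^ n
  | 0, h => Bool.toNat_lt _
  | n + 1, h => by
    have h0 := code_lt n (slice h 0)
    have h1 := code_lt n (slice h 1)
    have e : 2 ^ 2 ^ (n + 1) = 2 ^ 2 ^ n * 2 ^ 2 ^ n := by rw [← pow_add]; ring_nf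
    refine Nat.xor_lt_two_pow (h0.trans_le ?_) ?_
    · exact Nat.pow_le_pow_right two_pos (Nat.pow_le_pow_right two_pos n.le_succ)
    · rw [Nat.shiftLeft_eq, e]
      exact Nat.mul_lt_mul_of_pos_right h1 (by positivity)

theorem code_xor : ∀ (n : ℕ) (g h : SegrePoint n → Bool),
    code n (fun x => (g x ^^ h x)) = code n g ^^^ code n h
  | 0, g, h => by
    simp only [code]
    cases g Fin.elim0 <;> cases h Fin.elim0 <;> rfl
  | n + 1, g, h => by
    have ih0 := code_xor n (slice g 0) (slice h 0)
    have ih1 := code_xor n (slice g 1) (slice h 1)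
    simp only [code]
    change code n (fun x => (slice g 0 x ^^ slice h 0 x)) ^^^
      code n (fun x => (slice g 1 x ^^ slice h 1 x)) <<< 2 ^ n = _
    rw [ih0, ih1, Nat.shiftLeft_xor_distrib]
    ac_rfl

theorem sum_slice {n : ℕ} (h : SegrePoint (n + 1) → Bool) :
    ∑ x, (h x).toNat =
      ∑ x, (slice h 0 x).toNat + ∑ x, (slice h 1 x).toNat + ∑ x, (slice h 2 x).toNat := by
  rw [← (Fin.consEquiv fun _ : Fin (n + 1) => Fin 3).sum_comp, Fintype.sum_prod_type,
    Fin.sum_univ_three]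
  rfl

theorem sum_eq_weight : ∀ {n : ℕ} {h : SegrePoint n → Bool}, IsAdditive h →
    ∑ x, (h x).toNat = weight n (code n h)
  | 0, h, _ => by
    rw [Fintype.sum_unique]
    exact congrArg (fun x => (h x).toNat) (Subsingleton.elim _ _)
  | n + 1, h, hh => by
    have h0 := code_lt n (slice h 0)
    have hlo : code (n + 1) h % 2 ^ 2 ^ n = code n (slice h 0) := by
      rw [code, Nat.xor_mod_two_pow, Nat.mod_eq_of_lt h0, Nat.shiftLeft_eq, Nat.mul_mod_left,
        Nat.xor_zero]
    have hhi : code (n + 1) h >>> 2 ^ n = code n (slice h 1) := by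
      rw [code, Nat.shiftRight_xor_distrib, Nat.shiftRight_eq_div_pow, Nat.div_eq_of_lt h0,
        Nat.shiftLeft_shiftRight, Nat.zero_xor]
    rw [sum_slice, sum_eq_weight (hh.slice 0), sum_eq_weight (hh.slice 1),
      sum_eq_weight (hh.slice 2), hh.slice_two, code_xor, weight, hlo, hhi]

/-- The digits in base 16 are the halved weights of the additive functions on `S_(3)`. -/
def halfWeights : ℕ :=
  50182846907631970464873129432744669469847296430547922359581490869160201875705447834007781547235755736977130227089390422061333821655594614450363854500125113790132628528249643351500816029609992975930256238473881603195135012417729726887239755195588042563850379314713324393570164365473371953186646871092349912128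

/-- The weight of the additive function on `S_(3)` with code `a`, read off from `halfWeights`. -/
def halfWeight (a : ℕ) : ℕ := halfWeights >>> (4 * a) % 16

theorem weight_three : ∀ a < 256, weight 3 a = 2 * halfWeight a := by
  decide +kernel

/-- The binary digits mark the halved weights `0, 8, 12, 14, …, 25, 27` on `S_(4)`. -/
def admissible : ℕ := 201314561

/-- Whether `p` holds at all numbers below the bound. -/
def allBelow (p : ℕ → Bool) : ℕ → Bool
  | 0 => true
  | n + 1 => p n && allBelow p n

theorem of_allBelow {p : ℕ → Bool} : ∀ {n : ℕ}, allBelow p n = true → ∀ a < n, p a = true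
  | n + 1, h, a, ha => by
    rw [allBelow, Bool.and_eq_true] at h
    rcases Nat.lt_succ_iff_lt_or_eq.1 ha with hlt | rfl
    · exact of_allBelow h.2 a hlt
    · exact h.1

theorem allBelow_halfWeight : allBelow (fun a => allBelow (fun b =>
    Nat.beq (admissible >>> (halfWeight a + halfWeight b + halfWeight (a ^^^ b)) % 2) 1) (a + 1))
    256 = true := by
  decide +kernel

theorem admissible_halfWeight {a b : ℕ} (ha : a < 256) (hb : b < 256) :
    admissible >>> (halfWeight a + halfWeight b + halfWeight (a ^^^ b)) % 2 = 1 := by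
  wlog hba : b ≤ a generalizing a b
  · rw [add_comm (halfWeight a), Nat.xor_comm]
    exact this hb ha (le_of_not_ge hba)
  · have hrow := of_allBelow allBelow_halfWeight a ha
    exact Nat.eq_of_beq_eq_true (of_allBelow hrow b (Nat.lt_succ_of_le hba))

theorem mem_of_admissible {k : ℕ} (hk : admissible >>> k % 2 = 1) :
    k ∈ ({0, 8, 12, 14, 15, 16, 17, 18, 19, 20, 21, 22, 23, 24, 25, 27} : Finset ℕ) := by
  have hlt : k < 28 := by
    by_contra! hge
    have : admissible < 2 ^ k :=
      lt_of_lt_of_le (by decide) (Nat.pow_le_pow_right two_pos hge)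
    simp [Nat.shiftRight_eq_div_pow, Nat.div_eq_of_lt this] at hk
  revert hk
  interval_cases k <;> decide

/-- The weights of the additive functions on `S_(4)`. -/
theorem exists_sum_eq {h : SegrePoint 4 → Bool} (hh : IsAdditive h) :
    ∃ k ∈ ({0, 8, 12, 14, 15, 16, 17, 18, 19, 20, 21, 22, 23, 24, 25, 27} : Finset ℕ),
      ∑ x, (h x).toNat = 2 * k := by
  have h0 : code 3 (slice h 0) < 256 := code_lt 3 _
  have h1 : code 3 (slice h 1) < 256 := code_lt 3 _
  have h2 : code 3 (slice h 0) ^^^ code 3 (slice h 1) < 256 := Nat.xor_lt_two_pow (n := 8) h0 h1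
  refine ⟨_, mem_of_admissible (admissible_halfWeight h0 h1), ?_⟩
  rw [sum_slice, sum_eq_weight (hh.slice 0), sum_eq_weight (hh.slice 1),
    sum_eq_weight (hh.slice 2), hh.slice_two, code_xor, weight_three _ h0, weight_three _ h1,
    weight_three _ h2]
  ring

theorem mem_segreLine_iff {n : ℕ} {i : Fin n} {f x : SegrePoint n} :
    x ∈ segreLine i f ↔ ∃ k, x = Function.update f i k := by
  constructor
  · intro hx
    refine ⟨x i, funext fun j => ?_⟩
    by_cases hj : j = i
    · subst hj; simp
    · simpa [hj] using hx j hj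
  · rintro ⟨k, rfl⟩ j hj
    simp [hj]

open Classical in
theorem isAdditive_notMem {n : ℕ} {H : Set (SegrePoint n)} (hH : IsGeomHyperplane H) :
    IsAdditive fun x => decide (x ∉ H) := by
  intro i f
  have hmem (k : Fin 3) : Function.update f i k ∈ segreLine i f := mem_segreLine_iff.2 ⟨k, rfl⟩
  rcases hH.2 i f with hsub | hcard
  · simp [hsub (hmem 0), hsub (hmem 1), hsub (hmem 2)]
  · obtain ⟨p, hp⟩ := Set.ncard_eq_one.1 hcard
    have hpl : p ∈ segreLine i f ∩ H := hp ▸ rfl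
    obtain ⟨k, rfl⟩ := mem_segreLine_iff.1 hpl.1
    have key (l : Fin 3) : Function.update f i l ∈ H ↔ l = k := by
      constructor
      · intro hl
        have : Function.update f i l ∈ ({Function.update f i k} : Set (SegrePoint n)) :=
          hp ▸ ⟨hmem l, hl⟩
        exact Function.update_injective f i this
      · rintro rfl
        exact hpl.2
    simp only [key]
    fin_cases k <;> simp

open Classical in
theorem ncard_add_sum {n : ℕ} (H : Set (SegrePoint n)) :
    H.ncard + ∑ x, (decide (x ∉ H)).toNat = 3 ^ n := by
  have hc : ∑ x, (decide (x ∉ H)).toNat = Hᶜ.ncard := by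
    have hx (x : SegrePoint n) : (decide (x ∉ H)).toNat = if x ∈ Hᶜ then 1 else 0 := by
      by_cases h : x ∈ H <;> simp [h]
    simp_rw [hx]
    rw [← Finset.card_filter, Set.ncard_eq_toFinset_card']
    congr 1
    ext x
    simp
  rw [hc, Set.ncard_add_ncard_compl]
  simp

end Segre

theorem segre4_hyperplane_sizes :
    ∀ H : Set (SegrePoint 4), IsGeomHyperplane H →
      H.ncard ∈ ({65, 57, 53, 51, 49, 47, 45, 43, 41, 39, 37, 35, 33, 31, 27} : Set ℕ) := by
  classical
  intro H hH
  obtain ⟨k, hk, hsum⟩ := Segre.exists_sum_eq (Segre.isAdditive_notMem hH)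
  have hadd := Segre.ncard_add_sum H
  rw [hsum] at hadd
  have hne : H.ncard ≠ 3 ^ 4 := by
    intro h
    refine hH.1 ((Set.eq_univ_iff_ncard H).2 ?_)
    simp [h]
  simp only [Finset.mem_insert, Finset.mem_singleton] at hk
  simp only [Set.mem_insert_iff, Set.mem_singleton_iff]
  omega
end
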